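/- If the element w = (c^{s^{γ₁}})^{β₁}···(c^{s^{γₙ}})^{βₙ}·s^γ of (H Wr ℤ) Wr ℤ lies in the image of φ, then for every i ∈ {1,…,n} the sum ∑_{j : γⱼ = γᵢ} βⱼ equals 0. -/

import Mathlib

open SemidirectProduct

section WreathDef

variable (A B : Type*) [Group A] [Group B]

/-- The action of `B` on the base group `B → A` by `(b • f) x = f (x * b)`. -/
def wrAut : B →* MulAut (B → A) where
  toFun b :=
    { toFun := fun f x => f (x * b)
      invFun := fun f x => f (x * b⁻¹)
      left_inv := fun f => funext fun x => by simp
      right_inv := fun f => funext fun x => by simp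
      map_mul' := fun f g => rfl }
  map_one' := by
    ext f x
    simp
  map_mul' := fun b₁ b₂ => by
    ext f x
    simp [mul_assoc]

/-- The (unrestricted) wreath product `A Wr B`, as the semidirect product `(B → A) ⋊ B`. -/
abbrev Wr := (B → A) ⋊[wrAut A B] B

end WreathDef

/-- The infinite cyclic group `ℤ`, written multiplicatively. -/
abbrev Zm := Multiplicative ℤ

section Elements

variable {H : Type*} [Group H]

/-- The element `z` of `H Wr ℤ`: trivial passive part, active part `1 ∈ ℤ`. -/
def zElt : Wr H Zm := inr (Multiplicative.ofAdd 1)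

/-- The element `b i` of `H Wr ℤ`: passive part `k ↦ a i` for `k > 0` and `1` otherwise. -/
def bElt (a : ℕ → H) (i : ℕ) : Wr H Zm :=
  inl fun k => if 0 < Multiplicative.toAdd k then a i else 1

/-- The element `s` of `(H Wr ℤ) Wr ℤ`: trivial passive part, active part `1 ∈ ℤ`. -/
def sElt : Wr (Wr H Zm) Zm := inr (Multiplicative.ofAdd 1)

open Classical in
/-- The element `c` of `(H Wr ℤ) Wr ℤ`: base element with passive part sending
`1 ↦ z`, `2^i ↦ b i` for `i ≥ 1`, and everything else to `1`. -/
noncomputable def cElt (a : ℕ → H) : Wr (Wr H Zm) Zm :=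
  inl fun k =>
    if Multiplicative.toAdd k = 1 then zElt
    else if h : ∃ i : ℕ, 1 ≤ i ∧ Multiplicative.toAdd k = 2 ^ i then bElt a h.choose
    else 1

/-- The subgroup `G = ⟨c, s⟩` of `(H Wr ℤ) Wr ℤ`. -/
noncomputable def Gsub (a : ℕ → H) : Subgroup (Wr (Wr H Zm) Zm) :=
  Subgroup.closure {cElt a, sElt}

/-- The map `φ : H → (H Wr ℤ) Wr ℤ`, sending `h` to the base element supported at `1 ∈ ℤ`
whose value is the base element of `H Wr ℤ` supported at `0 ∈ ℤ` with value `h`. -/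
def phiElt (h : H) : Wr (Wr H Zm) Zm :=
  inl fun k =>
    if Multiplicative.toAdd k = 1 then
      (inl fun m => if Multiplicative.toAdd m = 0 then h else 1 : Wr H Zm)
    else 1

end Elements

/-- The base-subgroup element `f = (c^(s^(γ 1)))^(β 1) ⋯ (c^(s^(γ n)))^(β n)`,
where `x ^ y = y * x * y⁻¹`. -/
noncomputable def fProd {H : Type*} [Group H] (a : ℕ → H) {n : ℕ} (β γ : Fin n → ℤ) :
    Wr (Wr H Zm) Zm :=
  ((List.finRange n).map fun j => (sElt ^ γ j * cElt a * (sElt ^ γ j)⁻¹) ^ β j).prod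

/-- `γ₀ = max_j |γ j|`. -/
def gamma0 {n : ℕ} (γ : Fin n → ℤ) : ℕ :=
  Finset.univ.sup fun j => (γ j).natAbs

lemma sElt_zpow {H : Type*} [Group H] (m : ℤ) :
    (sElt : Wr (Wr H Zm) Zm) ^ m = inr (Multiplicative.ofAdd m) := by
  rw [sElt, ← map_zpow, ← ofAdd_zsmul, smul_eq_mul, mul_one]

lemma conj_sElt_zpow_inl {H : Type*} [Group H] (m : ℤ) (f : Zm → Wr H Zm) :
    sElt ^ m * inl f * (sElt ^ m)⁻¹ = inl fun x => f (x * Multiplicative.ofAdd m) := by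
  rw [sElt_zpow, ← map_inv, ← inl_aut]
  rfl

lemma toAdd_cElt_left_right {H : Type*} [Group H] (a : ℕ → H) (k : Zm) :
    Multiplicative.toAdd ((cElt a).left k).right =
      if Multiplicative.toAdd k = 1 then 1 else 0 := by
  simp only [cElt, left_inl]
  split_ifs <;> simp [zElt, bElt]

lemma fProd_eq_inl {H : Type*} [Group H] (a : ℕ → H) {n : ℕ} (β γ : Fin n → ℤ) :
    fProd a β γ = inl ((List.finRange n).map fun j =>
      (fun x => (cElt a).left (x * Multiplicative.ofAdd (γ j))) ^ β j).prod := by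
  have hc : cElt a = inl (cElt a).left := by simp [cElt]
  rw [fProd, map_list_prod, List.map_map]
  congr 2
  funext j
  rw [Function.comp_apply, map_zpow, ← conj_sElt_zpow_inl, ← hc]

lemma toAdd_fProd_left_right {H : Type*} [Group H] (a : ℕ → H) {n : ℕ} (β γ : Fin n → ℤ)
    (k : Zm) :
    Multiplicative.toAdd ((fProd a β γ).left k).right =
      ∑ j, if Multiplicative.toAdd k + γ j = 1 then β j else 0 := by
  let ψ : (Zm → Wr H Zm) →* Zm := rightHom.comp (Pi.evalMonoidHom _ k)
  have hψ (f : Zm → Wr H Zm) : (f k).right = ψ f := rfl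
  rw [fProd_eq_inl, left_inl, hψ, map_list_prod, List.map_map, ← List.ofFn_eq_map,
    List.prod_ofFn, toAdd_prod]
  refine Finset.sum_congr rfl fun j _ => ?_
  rw [Function.comp_apply, map_zpow, toAdd_zpow, ← hψ, toAdd_cElt_left_right]
  simp

/-- Lemma 5: if `(c^(s^(γ 1)))^(β 1) ⋯ (c^(s^(γ n)))^(β n) * s^γ ∈ φ(H)`,
then `∑_{j : γ j = γ i} β j = 0` for every `i`. -/
theorem stmt10 {H : Type*} [Group H] (a : ℕ → H)
    (hgen : Subgroup.closure {x : H | ∃ i : ℕ, 1 ≤ i ∧ a i = x} = ⊤)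
    (n : ℕ) (hn : 1 ≤ n) (β γ : Fin n → ℤ) (hβ : ∀ j, β j ≠ 0) (g : ℤ)
    (hw : fProd a β γ * sElt ^ g ∈ Set.range (phiElt (H := H))) :
    ∀ i : Fin n, (∑ j ∈ Finset.univ.filter fun j => γ j = γ i, β j) = 0 := by
  intro i
  obtain ⟨h, hh⟩ := hw
  let k : Zm := Multiplicative.ofAdd (1 - γ i)
  have hk : ((fProd a β γ * sElt ^ g).left k).right = ((fProd a β γ).left k).right := by
    rw [sElt_zpow, mul_left, left_inr, map_one, mul_one]
  have hφ : ((phiElt h).left k).right = 1 := by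
    simp only [phiElt, left_inl]
    split_ifs <;> simp
  rw [← hh, hφ] at hk
  have hsum := toAdd_fProd_left_right a β γ k
  rw [← hk, toAdd_one] at hsum
  rw [Finset.sum_filter]
  refine (Finset.sum_congr rfl fun j _ => if_congr ?_ rfl rfl).trans hsum.symm
  simp only [k, toAdd_ofAdd]
  omega
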